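/- Let n ≥ 1, k ≥ 1, and 1 ≤ t ≤ n be integers. The sum, over all partitions π in NC^k_B(n), of the number of unordered pairs {V, −V} of non-zero blocks of π with |V| = tk, equals nk·binom(n(k+1) − t − 1, nk − 1). -/

import Mathlib

open Finset

/-- A finpartition of a linearly ordered set is non-crossing if there are no
`a < b < c < d` with `a, c` in one block and `b, d` in a different block. -/
def IsNoncrossing {n : ℕ} (π : Finpartition (Finset.univ : Finset (Fin n))) : Prop :=
  ∀ a b c d : Fin n, a < b → b < c → c < d →
    ∀ B ∈ π.parts, ∀ C ∈ π.parts, a ∈ B → c ∈ B → b ∈ C → d ∈ C → B = C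

/-- Filter by an arbitrary (possibly non-decidable) predicate. -/
noncomputable def fil {α : Type*} (s : Finset α) (p : α → Prop) : Finset α :=
  letI := Classical.decPred p
  s.filter p

/-- Negation on `[±n] = {1,…,n,-1,…,-n}`, identified with `Fin (2n)` via
`i ↦ i - 1` and `-i ↦ n + i - 1` (zero-based).  It is given by adding `n` modulo `2n`. -/
def negB {n : ℕ} (x : Fin (2 * n)) : Fin (2 * n) :=
  ⟨(x.val + n) % (2 * n), Nat.mod_lt _ (by have := x.isLt; omega)⟩

/-- `-V` for a block `V`. -/
def negBlock {n : ℕ} (V : Finset (Fin (2 * n))) : Finset (Fin (2 * n)) :=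
  V.image negB

/-- `NCB n` : non-crossing partitions of type `B_n`, i.e. non-crossing partitions
of `[±n]` such that `-V` is a block whenever `V` is, with at most one block `V`
satisfying `-V = V` (the zero-block). -/
noncomputable def NCB (n : ℕ) : Finset (Finpartition (Finset.univ : Finset (Fin (2 * n)))) :=
  fil Finset.univ (fun π => IsNoncrossing π ∧ (∀ B ∈ π.parts, negBlock B ∈ π.parts) ∧
    (π.parts.filter (fun B => negBlock B = B)).card ≤ 1)

/-- The number of unordered pairs `{V, -V}` of non-zero blocks of `π` with `|V| = t`. -/
def pairCount {n : ℕ} (π : Finpartition (Finset.univ : Finset (Fin (2 * n)))) (t : ℕ) : ℕ :=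
  (π.parts.filter (fun B => negBlock B ≠ B ∧ B.card = t)).card / 2

/-- The number of unordered pairs `{V, -V}` of non-zero blocks of `π` (of any size). -/
def totalPairCount {n : ℕ} (π : Finpartition (Finset.univ : Finset (Fin (2 * n)))) : ℕ :=
  (π.parts.filter (fun B => negBlock B ≠ B)).card / 2

/-- The cardinality of the zero-block of `π` (`0` if there is no zero-block). -/
def zeroBlockSize {n : ℕ} (π : Finpartition (Finset.univ : Finset (Fin (2 * n)))) : ℕ :=
  ∑ B ∈ π.parts.filter (fun B => negBlock B = B), B.card

/-- `NCBdiv k n` : the `k`-divisible non-crossing partitions of type `B_{kn}`. -/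
noncomputable def NCBdiv (k n : ℕ) :
    Finset (Finpartition (Finset.univ : Finset (Fin (2 * (k * n))))) :=
  fil (NCB (k * n)) (fun π => ∀ B ∈ π.parts, k ∣ B.card)


structure BRel (N : ℤ) (r : ℤ → ℤ → Prop) : Prop where
  refl : ∀ x, r x x
  symm : ∀ x y, r x y → r y x
  trans : ∀ x y z, r x y → r y z → r x z
  shift : ∀ x y, r x y → r (x + N) (y + N)
  per : ∀ x, r x (x + 2 * N)
  nc : ∀ a b c d, a < b → b < c → c < d → d < a + 2 * N → r a c → r b d → r a b

structure Nest (N : ℤ) (own : ℤ → ℤ → Prop) : Prop where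
  func : ∀ j j' x, own j x → own j' x → j = j'
  le : ∀ j x, own j x → j ≤ x
  self : ∀ j x, own j x → own j j
  shift : ∀ j x, own j x → own (j + N) (x + N)
  unshift : ∀ j x, own (j + N) (x + N) → own j x
  nc : ∀ j x y, own j x → j ≤ y → y ≤ x → ∃ i, j ≤ i ∧ own i y

def ownR (N : ℤ) (r : ℤ → ℤ → Prop) (j x : ℤ) : Prop :=
  j ≤ x ∧ x < j + N ∧ r j x ∧ ¬ r j (j + N) ∧ ∀ y, j - N < y → y < j → ¬ r y j

def relO (N : ℤ) (own : ℤ → ℤ → Prop) (x y : ℤ) : Prop :=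
  (∃ j j', own j x ∧ own j' y ∧ ∃ q, j' = j + 2 * N * q) ∨
    ((∀ j, ¬ own j x) ∧ (∀ j, ¬ own j y))

def ownS (S : ℤ → ℤ) (j x : ℤ) : Prop :=
  j ≤ x ∧ S j ≤ S (x + 1) ∧ ∀ i, j < i → i ≤ x → S (x + 1) < S i

noncomputable def fib (N : ℤ) (own : ℤ → ℤ → Prop) (j : ℤ) : Finset ℤ :=
  fil (Finset.Ico j (j + N)) (fun x => own j x)

noncomputable def cnt (N : ℤ) (own : ℤ → ℤ → Prop) (j : ℤ) : ℕ := (fib N own j).card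

theorem mem_fil {α : Type*} (s : Finset α) (p : α → Prop) (x : α) :
    x ∈ fil s p ↔ x ∈ s ∧ p x := by
  classical
  unfold fil
  simp

theorem mem_fib (N : ℤ) (own : ℤ → ℤ → Prop) (j x : ℤ) :
    x ∈ fib N own j ↔ (j ≤ x ∧ x < j + N) ∧ own j x := by
  simp [fib, mem_fil]

namespace BRel

variable {N : ℤ} {r : ℤ → ℤ → Prop}

theorem unshift (h : BRel N r) (x y : ℤ) (hxy : r (x + N) (y + N)) : r x y := by
  have h1 := h.shift _ _ hxy
  have h2 := h.per x
  have h3 := h.per y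
  rw [show x + N + N = x + 2 * N by ring, show y + N + N = y + 2 * N by ring] at h1
  exact h.trans _ _ _ h2 (h.trans _ _ _ h1 (h.symm _ _ h3))

theorem perq (h : BRel N r) (x q : ℤ) : r x (x + 2 * N * q) := by
  induction q using Int.induction_on with
  | zero => simpa using h.refl x
  | succ i ih =>
    have := h.per (x + 2 * N * i)
    rw [show x + 2 * N * i + 2 * N = x + 2 * N * (i + 1) by ring] at this
    exact h.trans _ _ _ ih this
  | pred i ih =>
    have := h.per (x + 2 * N * (-i - 1))
    rw [show x + 2 * N * (-i - 1) + 2 * N = x + 2 * N * (-i) by ring] at this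
    exact h.trans _ _ _ ih (h.symm _ _ this)

theorem zero_congr (h : BRel N r) (x y : ℤ) (hxy : r x y) (hx : r x (x + N)) : r y (y + N) :=
  h.trans _ _ _ (h.symm _ _ hxy) (h.trans _ _ _ hx (h.shift _ _ hxy))

theorem zero_q (h : BRel N r) (x q : ℤ) (hx : r x (x + N)) : r x (x + N * q) := by
  induction q using Int.induction_on with
  | zero => simpa using h.refl x
  | succ i ih =>
    have := h.zero_congr _ _ ih hx
    rw [show x + N * i + N = x + N * (i + 1) by ring] at this
    exact h.trans _ _ _ ih this
  | pred i ih =>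
    have := h.zero_congr _ _ ih hx
    rw [show x + N * (-i) = x + N * (-i - 1) + N by ring] at this
    have := h.unshift _ _ this
    rw [show x + N * (-i - 1) + N = x + N * (-i) by ring] at this
    exact h.trans _ _ _ ih (h.symm _ _ this)

/-- all zero points are related -/
theorem zero_rel (h : BRel N r) (hN : 0 < N) (x y : ℤ) (hx : r x (x + N)) (hy : r y (y + N)) :
    r x y := by
  obtain ⟨q, z, hz0, hz1, hyz⟩ : ∃ q z, x ≤ z ∧ z < x + N ∧ z = y + N * q := by
    refine ⟨-((y - x) / N), x + (y - x) % N, ?_, ?_, ?_⟩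
    · have := Int.emod_nonneg (y - x) hN.ne'
      omega
    · have := Int.emod_lt_of_pos (y - x) hN
      omega
    · have := Int.emod_add_mul_ediv (y - x) N
      linarith
  have h1 : r y z := hyz ▸ h.zero_q y q hy
  have hz := h.zero_congr _ _ h1 hy
  rcases eq_or_lt_of_le hz0 with e | e
  · subst e; exact h.symm _ _ h1
  · exact h.trans _ _ _ (h.nc x z (x + N) (z + N) e hz1 (by omega) (by omega) hx hz)
      (h.symm _ _ h1)

theorem exists_own (h : BRel N r) (hN : 0 < N) (y : ℤ) (hy : ¬ r y (y + N)) :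
    ∃ i, ownR N r i y := by
  obtain ⟨i, ⟨hi1, hi2, hi3⟩, hmin⟩ := Int.exists_least_of_bdd
    (P := fun z => y - N < z ∧ z ≤ y ∧ r z y) ⟨y - N, fun z hz => hz.1.le⟩
    ⟨y, by omega, le_refl _, h.refl y⟩
  have hi4 : ¬ r i (i + N) := fun hh => hy (h.zero_congr _ _ hi3 hh)
  refine ⟨i, hi2, by omega, hi3, hi4, ?_⟩
  intro z hz1 hz2 hz
  have hzy := h.trans _ _ _ hz hi3
  by_cases hc : y - N < z
  · have := hmin z ⟨hc, by omega, hzy⟩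
    omega
  have hyN : ¬ r (y - N) y := fun hh => by
    have := h.shift _ _ hh
    rw [show y - N + N = y by ring] at this
    exact hy this
  rcases eq_or_lt_of_le (not_lt.1 hc) with e | e
  · subst e; exact hyN hzy
  · have h1 : r (y - N) (z + N) := by
      apply h.unshift
      rw [show y - N + N = y by ring, show z + N + N = z + 2 * N by ring]
      exact h.trans _ _ _ (h.symm _ _ hzy) (h.per z)
    have := h.nc z (y - N) i (z + N) e (by omega) (by omega) (by omega) hz h1
    exact hyN (h.trans _ _ _ (h.symm _ _ this) hzy)

theorem nest (h : BRel N r) (hN : 0 < N) : Nest N (ownR N r) where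
  func := by
    have key : ∀ j j' x, ownR N r j x → ownR N r j' x → ¬ j < j' := by
      rintro j j' x ⟨a1, a2, a3, a4, a5⟩ ⟨b1, b2, b3, b4, b5⟩ hlt
      exact b5 j (by omega) hlt (h.trans _ _ _ a3 (h.symm _ _ b3))
    intro j j' x h1 h2
    have := key _ _ _ h1 h2
    have := key _ _ _ h2 h1
    omega
  le := fun j x hh => hh.1
  self := by
    rintro j x ⟨a1, a2, a3, a4, a5⟩
    exact ⟨le_refl _, by omega, h.refl j, a4, a5⟩
  shift := by
    rintro j x ⟨a1, a2, a3, a4, a5⟩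
    refine ⟨by omega, by omega, h.shift _ _ a3, fun hh => a4 (h.unshift _ _ hh), ?_⟩
    intro y hy1 hy2 hy
    apply a5 (y - N) (by omega) (by omega)
    apply h.unshift
    simpa using hy
  unshift := by
    rintro j x ⟨a1, a2, a3, a4, a5⟩
    refine ⟨by omega, by omega, h.unshift _ _ a3, fun hh => a4 (h.shift _ _ hh), ?_⟩
    intro y hy1 hy2 hy
    exact a5 (y + N) (by omega) (by omega) (h.shift _ _ hy)
  nc := by
    rintro j x y ⟨a1, a2, a3, a4, a5⟩ hjy hyx
    rcases eq_or_lt_of_le hjy with e | e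
    · subst e
      exact ⟨j, le_refl _, le_refl _, by omega, h.refl j, a4, a5⟩
    rcases eq_or_lt_of_le hyx with e' | e'
    · subst e'
      exact ⟨j, le_refl _, a1, a2, a3, a4, a5⟩
    have hy : ¬ r y (y + N) := by
      intro hy
      have := h.nc j y x (y + N) e e' (by omega) (by omega) a3 hy
      exact a4 (h.zero_congr _ _ (h.symm _ _ this) hy)
    obtain ⟨i, b1, b2, b3, b4, b5⟩ := h.exists_own hN y hy
    refine ⟨i, ?_, b1, b2, b3, b4, b5⟩
    by_contra hlt
    have := h.nc i j y x (by omega) e e' (by omega) b3 a3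
    exact a5 i (by omega) (by omega) this

theorem opener_unique (h : BRel N r) (hN : 0 < N) (j j' : ℤ) (hj : ownR N r j j)
    (hj' : ownR N r j' j') (hr : r j j') : ∃ q, j' = j + 2 * N * q := by
  obtain ⟨q, z, hz0, hz1, hyz⟩ : ∃ q z, j - N ≤ z ∧ z < j + N ∧ z = j' + 2 * N * q := by
    refine ⟨-((j' - (j - N)) / (2 * N)), (j - N) + (j' - (j - N)) % (2 * N), ?_, ?_, ?_⟩
    · have := Int.emod_nonneg (j' - (j - N)) (b := 2 * N) (by omega)
      omega
    · have := Int.emod_lt_of_pos (j' - (j - N)) (b := 2 * N) (by omega)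
      omega
    · have := Int.emod_add_mul_ediv (j' - (j - N)) (2 * N)
      linarith
  obtain ⟨a1, a2, a3, a4, a5⟩ := hj
  obtain ⟨b1, b2, b3, b4, b5⟩ := hj'
  have h1 : r j' z := hyz ▸ h.perq j' q
  have hjz : r j z := h.trans _ _ _ hr h1
  refine ⟨-q, ?_⟩
  suffices z = j by linarith
  rcases lt_trichotomy z j with hlt | heq | hgt
  · exfalso
    rcases eq_or_lt_of_le hz0 with e | e
    · rw [← e] at hjz
      have := h.shift _ _ (h.symm _ _ hjz)
      simp only [sub_add_cancel] at this
      exact a4 this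
    · exact a5 z e hlt (h.symm _ _ hjz)
  · exact heq
  · exfalso
    refine b5 (j - 2 * N * q) (by linarith) (by linarith) ?_
    have := h.perq (j - 2 * N * q) q
    rw [sub_add_cancel] at this
    exact h.trans _ _ _ this hr

theorem not_own (h : BRel N r) (x : ℤ) (hx : r x (x + N)) (j : ℤ) : ¬ ownR N r j x := by
  rintro ⟨a1, a2, a3, a4, a5⟩
  exact a4 (h.zero_congr _ _ (h.symm _ _ a3) hx)

theorem recover (h : BRel N r) (hN : 0 < N) (x y : ℤ) : r x y ↔ relO N (ownR N r) x y := by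
  constructor
  · intro hxy
    by_cases hx : r x (x + N)
    · right
      exact ⟨h.not_own x hx, h.not_own y (h.zero_congr _ _ hxy hx)⟩
    · left
      have hy : ¬ r y (y + N) := fun hh => hx (h.zero_congr _ _ (h.symm _ _ hxy) hh)
      obtain ⟨i, hi⟩ := h.exists_own hN x hx
      obtain ⟨j, hj⟩ := h.exists_own hN y hy
      refine ⟨i, j, hi, hj, h.opener_unique hN _ _ ((h.nest hN).self _ _ hi)
        ((h.nest hN).self _ _ hj) ?_⟩
      exact h.trans _ _ _ hi.2.2.1 (h.trans _ _ _ hxy (h.symm _ _ hj.2.2.1))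
  · rintro (⟨j, j', hj, hj', q, hq⟩ | ⟨hx, hy⟩)
    · have h1 := h.perq j q
      rw [← hq] at h1
      exact h.trans _ _ _ (h.symm _ _ hj.2.2.1) (h.trans _ _ _ h1 hj'.2.2.1)
    · apply h.zero_rel hN
      · by_contra hh
        obtain ⟨i, hi⟩ := h.exists_own hN x hh
        exact hx i hi
      · by_contra hh
        obtain ⟨i, hi⟩ := h.exists_own hN y hh
        exact hy i hi

end BRel

namespace Nest

variable {N : ℤ} {own : ℤ → ℤ → Prop}

theorem lt (h : Nest N own) (hN : 0 < N) (j x : ℤ) (hx : own j x) : x < j + N := by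
  by_contra hh
  obtain ⟨i, hi, hi'⟩ := h.nc (j + N) (x + N) x (h.shift _ _ hx) (by omega) (by omega)
  have := h.func _ _ _ hi' hx
  omega

theorem shift2 (h : Nest N own) (j x : ℤ) (hx : own j x) : own (j + 2 * N) (x + 2 * N) := by
  have := h.shift _ _ (h.shift _ _ hx)
  rwa [show j + N + N = j + 2 * N by ring, show x + N + N = x + 2 * N by ring] at this

theorem unshift2 (h : Nest N own) (j x : ℤ) (hx : own (j + 2 * N) (x + 2 * N)) : own j x := by
  rw [show j + 2 * N = j + N + N by ring, show x + 2 * N = x + N + N by ring] at hx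
  exact h.unshift _ _ (h.unshift _ _ hx)

theorem shiftq (h : Nest N own) (j x q : ℤ) (hx : own j x) : own (j + N * q) (x + N * q) := by
  induction q using Int.induction_on with
  | zero => simpa using hx
  | succ i ih =>
    have := h.shift _ _ ih
    convert this using 1 <;> ring
  | pred i ih =>
    apply h.unshift
    convert ih using 1 <;> ring

theorem q_cases (N q a b : ℤ) (hN : 0 < N) (hab : b = a + 2 * N * q) (h1 : a - N < b)
    (h2 : b < a + 3 * N) : b = a ∨ b = a + 2 * N := by
  have hq0 : -1 < q := by
    by_contra hh
    have : N * (q + 1) ≤ 0 := mul_nonpos_of_nonneg_of_nonpos hN.le (by omega)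
    linarith
  have hq2 : q < 2 := by
    by_contra hh
    have : 0 ≤ N * (q - 2) := mul_nonneg hN.le (by omega)
    linarith
  have : q = 0 ∨ q = 1 := by omega
  rcases this with rfl | rfl
  · left; linarith
  · right; linarith

theorem brel (h : Nest N own) (hN : 0 < N) : BRel N (relO N own) where
  refl := by
    intro x
    by_cases hx : ∃ j, own j x
    · obtain ⟨j, hj⟩ := hx
      exact Or.inl ⟨j, j, hj, hj, 0, by ring⟩
    · push Not at hx
      exact Or.inr ⟨hx, hx⟩
  symm := by
    rintro x y (⟨j, j', hj, hj', q, hq⟩ | ⟨hx, hy⟩)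
    · exact Or.inl ⟨j', j, hj', hj, -q, by rw [hq]; ring⟩
    · exact Or.inr ⟨hy, hx⟩
  trans := by
    rintro x y z (⟨j, j', hj, hj', q, hq⟩ | ⟨hx, hy⟩) (⟨i, i', hi, hi', p, hp⟩ | ⟨hx', hy'⟩)
    · have := h.func _ _ _ hj' hi
      exact Or.inl ⟨j, i', hj, hi', q + p, by rw [hp, ← this, hq]; ring⟩
    · exact absurd hj' (hx' _)
    · exact absurd hi (hy _)
    · exact Or.inr ⟨hx, hy'⟩
  shift := by
    rintro x y (⟨j, j', hj, hj', q, hq⟩ | ⟨hx, hy⟩)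
    · exact Or.inl ⟨j + N, j' + N, h.shift _ _ hj, h.shift _ _ hj', q, by rw [hq]; ring⟩
    · refine Or.inr ⟨fun j hj => hx (j - N) (h.unshift _ _ ?_),
        fun j hj => hy (j - N) (h.unshift _ _ ?_)⟩ <;> simpa using hj
  per := by
    intro x
    by_cases hx : ∃ j, own j x
    · obtain ⟨j, hj⟩ := hx
      exact Or.inl ⟨j, j + 2 * N, hj, h.shift2 _ _ hj, 1, by ring⟩
    · push Not at hx
      refine Or.inr ⟨hx, fun j hj => hx (j - 2 * N) (h.unshift2 _ _ ?_)⟩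
      simpa using hj
  nc := by
    rintro a b c d hab hbc hcd hda (⟨α, γ, hα, hγ, q, hq⟩ | ⟨ha, hc⟩)
      (⟨β, δ, hβ, hδ, p, hp⟩ | ⟨hb, hd⟩)
    · have a1 := h.le _ _ hα
      have a2 := h.lt hN _ _ hα
      have b1 := h.le _ _ hβ
      have b2 := h.lt hN _ _ hβ
      have c1 := h.le _ _ hγ
      have c2 := h.lt hN _ _ hγ
      have d1 := h.le _ _ hδ
      have d2 := h.lt hN _ _ hδ
      have hα2 := h.shift2 _ _ hα
      have hβ2 := h.shift2 _ _ hβ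
      left
      rcases q_cases N q α γ hN hq (by omega) (by omega) with e | e <;>
      rcases q_cases N p β δ hN hp (by omega) (by omega) with e' | e' <;> clear hq hp
      · rw [e] at hγ
        rw [e'] at hδ
        obtain ⟨i, hi, hi'⟩ := h.nc α c b hγ (by omega) (by omega)
        have := h.func _ _ _ hi' hβ
        obtain ⟨k, hk, hk'⟩ := h.nc β d c hδ (by omega) (by omega)
        have := h.func _ _ _ hk' hγ
        exact ⟨α, β, hα, hβ, 0, by omega⟩
      · rw [e] at hγ
        obtain ⟨i, hi, hi'⟩ := h.nc α c b hγ (by omega) (by omega)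
        have := h.func _ _ _ hi' hβ
        obtain ⟨k, hk, hk'⟩ := h.nc β b a hβ (by omega) (by omega)
        have := h.func _ _ _ hk' hα
        exact ⟨α, β, hα, hβ, 0, by omega⟩
      · rw [← e] at hα2
        rw [e'] at hδ
        obtain ⟨i, hi, hi'⟩ := h.nc γ (a + 2 * N) d hα2 (by omega) (by omega)
        have := h.func _ _ _ hi' hδ
        obtain ⟨k, hk, hk'⟩ := h.nc β d c hδ (by omega) (by omega)
        have := h.func _ _ _ hk' hγ
        exact ⟨α, β, hα, hβ, 1, by omega⟩
      · rw [← e] at hα2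
        rw [← e'] at hβ2
        obtain ⟨i, hi, hi'⟩ := h.nc γ (a + 2 * N) d hα2 (by omega) (by omega)
        have := h.func _ _ _ hi' hδ
        obtain ⟨k, hk, hk'⟩ := h.nc δ (b + 2 * N) (a + 2 * N) hβ2 (by omega) (by omega)
        have := h.func _ _ _ hk' hα2
        exact ⟨α, β, hα, hβ, 0, by omega⟩
    · exfalso
      have a1 := h.le _ _ hα
      have a2 := h.lt hN _ _ hα
      have c1 := h.le _ _ hγ
      have c2 := h.lt hN _ _ hγ
      have hα2 := h.shift2 _ _ hα
      rcases q_cases N q α γ hN hq (by omega) (by omega) with e | e <;> clear hq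
      · rw [e] at hγ
        obtain ⟨i, hi, hi'⟩ := h.nc α c b hγ (by omega) (by omega)
        exact hb _ hi'
      · rw [← e] at hα2
        obtain ⟨i, hi, hi'⟩ := h.nc γ (a + 2 * N) d hα2 (by omega) (by omega)
        exact hd _ hi'
    · exfalso
      have b1 := h.le _ _ hβ
      have b2 := h.lt hN _ _ hβ
      have d1 := h.le _ _ hδ
      have d2 := h.lt hN _ _ hδ
      rcases q_cases N p β δ hN hp (by omega) (by omega) with e | e <;> clear hp
      · rw [e] at hδ
        obtain ⟨i, hi, hi'⟩ := h.nc β d c hδ (by omega) (by omega)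
        exact hc _ hi'
      · obtain ⟨i, hi, hi'⟩ := h.nc β b a hβ (by omega) (by omega)
        exact ha _ hi'
    · exact Or.inr ⟨ha, hb⟩

theorem recover (h : Nest N own) (hN : 0 < N) (j x : ℤ) :
    ownR N (relO N own) j x ↔ own j x := by
  constructor
  · rintro ⟨a1, a2, a3, a4, a5⟩
    have hj : ∃ i, own i j := by
      by_contra hh
      push Not at hh
      apply a4
      refine Or.inr ⟨hh, fun i hi => hh (i - N) (h.unshift _ _ ?_)⟩
      simpa using hi
    obtain ⟨i, hi⟩ := hj
    have c1 := h.le _ _ hi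
    have c2 := h.lt hN _ _ hi
    have hij : i = j := by
      by_contra hne
      exact a5 i (by omega) (by omega) (Or.inl ⟨i, i, h.self _ _ hi, hi, 0, by ring⟩)
    subst hij
    rcases a3 with ⟨l, l', hl, hl', q, hq⟩ | ⟨hx, hy⟩
    · have := h.func _ _ _ hl hi
      subst this
      have d1 := h.le _ _ hl'
      have d2 := h.lt hN _ _ hl'
      rcases q_cases N q l l' hN hq (by omega) (by omega) with e | e
      · rwa [e] at hl'
      · omega
    · exact absurd hi (hx _)
  · intro hx
    have c1 := h.le _ _ hx
    have c2 := h.lt hN _ _ hx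
    have hs := h.self _ _ hx
    refine ⟨c1, c2, Or.inl ⟨j, j, hs, hx, 0, by ring⟩, ?_, ?_⟩
    · rintro (⟨l, l', hl, hl', q, hq⟩ | ⟨hx, hy⟩)
      · have e1 := h.func _ _ _ hl hs
        have e2 := h.func _ _ _ hl' (h.shift _ _ hs)
        rcases q_cases N q l l' hN hq (by omega) (by omega) with e | e <;> omega
      · exact hx _ hs
    · intro y hy1 hy2
      rintro (⟨l, l', hl, hl', q, hq⟩ | ⟨hx, hy⟩)
      · have e1 := h.func _ _ _ hl' hs
        have d1 := h.le _ _ hl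
        have d2 := h.lt hN _ _ hl
        rcases q_cases N q l l' hN hq (by omega) (by omega) with e | e <;> omega
      · exact hy _ hs

end Nest

/-! ### From nests to counting functions and walks -/

namespace Nest

variable {N : ℤ} {own : ℤ → ℤ → Prop}

theorem cnt_per (h : Nest N own) (j : ℤ) : cnt N own (j + N) = cnt N own j := by
  unfold cnt
  symm
  refine Finset.card_bij (fun x _ => x + N) ?_ ?_ ?_
  · intro x hx
    rw [mem_fib] at hx ⊢
    exact ⟨⟨by omega, by omega⟩, h.shift _ _ hx.2⟩
  · intro x _ y _ hxy
    simpa using hxy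
  · intro y hy
    rw [mem_fib] at hy
    refine ⟨y - N, ?_, by ring⟩
    rw [mem_fib]
    refine ⟨⟨by omega, by omega⟩, h.unshift _ _ ?_⟩
    simpa using hy.2

theorem fib_disj (h : Nest N own) (s : Set ℤ) : s.PairwiseDisjoint (fib N own) := by
  intro i _ j _ hij
  rw [Function.onFun, Finset.disjoint_left]
  intro x hx hx'
  rw [mem_fib] at hx hx'
  exact hij (h.func _ _ _ hx.2 hx'.2)

theorem sum_cnt (h : Nest N own) (s : Finset ℤ) :
    ∑ j ∈ s, cnt N own j = (s.biUnion (fib N own)).card := by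
  rw [Finset.card_biUnion (fun i _ j _ hij => h.fib_disj Set.univ trivial trivial hij)]
  rfl

theorem sum_period (h : Nest N own) (hN : 0 < N) :
    ((∑ j ∈ Finset.Ico 0 N, cnt N own j : ℕ) : ℤ) ≤ N := by
  rw [h.sum_cnt]
  have : ((Finset.Ico 0 N).biUnion (fib N own)).card ≤ (Finset.Ico 0 N).card := by
    refine Finset.card_le_card_of_injOn (fun x => x % N) ?_ ?_
    · intro x _
      simp only [Finset.coe_Ico, Set.mem_Ico]
      exact ⟨Int.emod_nonneg _ hN.ne', Int.emod_lt_of_pos _ hN⟩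
    · intro x hx y hy hxy
      simp only [Finset.coe_biUnion, Set.mem_iUnion, Finset.mem_coe, mem_fib, Finset.mem_Ico] at hx hy
      obtain ⟨i, hi, _, hi'⟩ := hx
      obtain ⟨j, hj, _, hj'⟩ := hy
      obtain ⟨q, hq⟩ := Int.ModEq.dvd (show x ≡ y [ZMOD N] from hxy)
      have h1 := h.shiftq _ _ q hi'
      rw [show x + N * q = y by linarith] at h1
      have h2 := h.func _ _ _ h1 hj'
      have hq0 : q = 0 := by
        by_contra hne
        rcases lt_or_gt_of_ne hne with hlt | hgt
        · have : N * (q + 1) ≤ 0 := mul_nonpos_of_nonneg_of_nonpos hN.le (by omega)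
          linarith
        · have : 0 ≤ N * (q - 1) := mul_nonneg hN.le (by omega)
          linarith
      subst hq0
      linarith
  have h2 : ((Finset.Ico 0 N).card : ℤ) = N := by
    rw [Int.card_Ico]; simp [hN.le]
  omega

theorem sum_small (h : Nest N own) (i x : ℤ) (hix : i ≤ x)
    (hx : ∀ l, i ≤ l → ¬ own l x) :
    ((∑ j ∈ Finset.Ico i (x + 1), cnt N own j : ℕ) : ℤ) ≤ x - i := by
  rw [h.sum_cnt]
  have : (Finset.Ico i (x + 1)).biUnion (fib N own) ⊆ Finset.Ico i x := by
    intro y hy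
    simp only [Finset.mem_biUnion, mem_fib, Finset.mem_Ico] at hy ⊢
    obtain ⟨l, hl, hl1, hl2⟩ := hy
    refine ⟨by omega, ?_⟩
    by_contra hh
    obtain ⟨m, hm, hm'⟩ := h.nc l y x hl2 (by omega) (by omega)
    exact hx m (by omega) hm'
  have h1 := Finset.card_le_card this
  have h2 : ((Finset.Ico i x).card : ℤ) = x - i := by
    rw [Int.card_Ico]; simp [hix]
  omega

theorem sum_large (h : Nest N own) (hN : 0 < N) (j x : ℤ) (hx : own j x) :
    x + 1 - j ≤ ((∑ j ∈ Finset.Ico j (x + 1), cnt N own j : ℕ) : ℤ) := by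
  rw [h.sum_cnt]
  have hjx := h.le _ _ hx
  have : Finset.Ico j (x + 1) ⊆ (Finset.Ico j (x + 1)).biUnion (fib N own) := by
    intro y hy
    simp only [Finset.mem_biUnion, mem_fib, Finset.mem_Ico] at hy ⊢
    obtain ⟨i, hi, hi'⟩ := h.nc j x y hx (by omega) (by omega)
    have h1 := h.le _ _ hi'
    have h2 := h.lt hN _ _ hi'
    exact ⟨i, by omega, by omega, hi'⟩
  have h1 := Finset.card_le_card this
  have h2 : ((Finset.Ico j (x + 1)).card : ℤ) = x + 1 - j := by
    rw [Int.card_Ico]; simp; omega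
  omega

end Nest

theorem walk_exists (f : ℤ → ℤ) : ∃ S : ℤ → ℤ, ∀ x, S (x + 1) = S x + f x := by
  refine ⟨fun x => ∑ i ∈ Finset.Ico 0 x, f i - ∑ i ∈ Finset.Ico x 0, f i, ?_⟩
  intro x
  by_cases hx : 0 ≤ x
  · simp only [Finset.Ico_eq_empty (a := x) (b := 0) (by omega),
      Finset.Ico_eq_empty (a := x + 1) (b := 0) (by omega)]
    have : Finset.Ico 0 (x + 1) = insert x (Finset.Ico 0 x) := by
      ext y; simp only [Finset.mem_Ico, Finset.mem_insert]; omega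
    rw [this, Finset.sum_insert (by simp)]
    simp; ring
  · simp only [Finset.Ico_eq_empty (a := 0) (b := x) (by omega),
      Finset.Ico_eq_empty (a := 0) (b := x + 1) (by omega)]
    have : Finset.Ico x 0 = insert x (Finset.Ico (x + 1) 0) := by
      ext y; simp only [Finset.mem_Ico, Finset.mem_insert]; omega
    rw [this, Finset.sum_insert (by simp)]
    simp

theorem walk_sum (f : ℤ → ℕ) (S : ℤ → ℤ) (hS : ∀ x, S (x + 1) = S x + f x - 1) (a b : ℤ)
    (hab : a ≤ b) : S b = S a + ((∑ i ∈ Finset.Ico a b, f i : ℕ) : ℤ) - (b - a) := by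
  induction b, hab using Int.leInduction with
  | base => simp
  | succ b hab ih =>
    have : Finset.Ico a (b + 1) = insert b (Finset.Ico a b) := by
      ext y; simp only [Finset.mem_Ico, Finset.mem_insert]; omega
    rw [this, Finset.sum_insert (by simp), hS, ih]
    push_cast
    ring

theorem walk_drift (N : ℤ) (f : ℤ → ℕ) (S : ℤ → ℤ) (hS : ∀ x, S (x + 1) = S x + f x - 1)
    (hf : ∀ x, f (x + N) = f x) (x : ℤ) : S (x + N) - S x = S N - S 0 := by
  induction x using Int.induction_on with
  | zero => simp
  | succ i ih =>
    have h1 := hS (i + N)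
    rw [hf] at h1
    have h2 := hS i
    rw [show (i : ℤ) + 1 + N = i + N + 1 by ring]
    linarith
  | pred i ih =>
    have h1 := hS (-i - 1 + N)
    rw [hf] at h1
    have h2 := hS (-i - 1)
    rw [show (-i - 1 + N + 1 : ℤ) = -i + N by ring] at h1
    rw [show (-i - 1 + 1 : ℤ) = -i by ring] at h2
    linarith

theorem ownS_func (S : ℤ → ℤ) (j j' x : ℤ) (h : ownS S j x) (h' : ownS S j' x) : j = j' := by
  obtain ⟨a1, a2, a3⟩ := h
  obtain ⟨b1, b2, b3⟩ := h'
  rcases lt_trichotomy j j' with hlt | heq | hgt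
  · have := a3 j' hlt b1; omega
  · exact heq
  · have := b3 j hgt a1; omega

/-- a nest is recovered from its counting function -/
theorem Nest.recoverS {N : ℤ} {own : ℤ → ℤ → Prop} (h : Nest N own) (hN : 0 < N) (S : ℤ → ℤ)
    (hS : ∀ x, S (x + 1) = S x + cnt N own x - 1) (j x : ℤ) : ownS S j x ↔ own j x := by
  have key : ∀ j x, own j x → ownS S j x := by
    intro j x hx
    have hle := h.le _ _ hx
    refine ⟨hle, ?_, ?_⟩
    · have h1 := h.sum_large hN j x hx
      have h2 := walk_sum _ S hS j (x + 1) (by omega)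
      omega
    · intro i hi hix
      have h1 := h.sum_small i x hix (fun l hl hl' => by
        have := h.func _ _ _ hl' hx; omega)
      have h2 := walk_sum _ S hS i (x + 1) (by omega)
      omega
  refine ⟨fun hx => ?_, key j x⟩
  by_cases hex : ∃ i, own i x
  · obtain ⟨i, hi⟩ := hex
    have := ownS_func S _ _ _ (key _ _ hi) hx
    rwa [this] at hi
  · push Not at hex
    obtain ⟨a1, a2, a3⟩ := hx
    have h1 := h.sum_small j x a1 (fun l _ => hex l)
    have h2 := walk_sum _ S hS j (x + 1) (by omega)
    omega

theorem ownS_nest (N D : ℤ) (S : ℤ → ℤ) (hD : ∀ x, S (x + N) = S x - D) :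
    Nest N (ownS S) where
  func := ownS_func S
  le := fun j x h => h.1
  self := by
    rintro j x ⟨a1, a2, a3⟩
    refine ⟨le_refl _, ?_, fun i hi hi' => by omega⟩
    rcases eq_or_lt_of_le a1 with e | e
    · subst e; exact a2
    · have := a3 (j + 1) (by omega) (by omega)
      omega
  shift := by
    rintro j x ⟨a1, a2, a3⟩
    refine ⟨by omega, ?_, ?_⟩
    · rw [show x + N + 1 = x + 1 + N by ring, hD, hD]; omega
    · intro i hi hi'
      have := a3 (i - N) (by omega) (by omega)
      have h2 := hD (i - N)
      rw [sub_add_cancel] at h2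
      rw [show x + N + 1 = x + 1 + N by ring, hD]; omega
  unshift := by
    rintro j x ⟨a1, a2, a3⟩
    rw [show x + N + 1 = x + 1 + N by ring, hD, hD] at a2
    refine ⟨by omega, by omega, ?_⟩
    intro i hi hi'
    have := a3 (i + N) (by omega) (by omega)
    rw [show x + N + 1 = x + 1 + N by ring, hD, hD] at this
    omega
  nc := by
    rintro j x y ⟨a1, a2, a3⟩ hjy hyx
    have hj : S j ≤ S (y + 1) := by
      rcases eq_or_lt_of_le hyx with e | e
      · subst e; exact a2
      · have := a3 (y + 1) (by omega) (by omega); omega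
    obtain ⟨i, ⟨hi1, hi2, hi3⟩, hmax⟩ := Int.exists_greatest_of_bdd
      (P := fun i => j ≤ i ∧ i ≤ y ∧ S i ≤ S (y + 1)) ⟨y, fun z hz => hz.2.1⟩
      ⟨j, le_refl _, hjy, hj⟩
    refine ⟨i, hi1, hi2, hi3, ?_⟩
    intro z hz hz'
    by_contra hh
    have := hmax z ⟨by omega, hz', by omega⟩
    omega

theorem ownS_cnt (N D : ℤ) (hN : 0 < N) (hD0 : 0 ≤ D) (f : ℤ → ℕ) (S : ℤ → ℤ)
    (hS : ∀ x, S (x + 1) = S x + f x - 1)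
    (hD : ∀ x, S (x + N) = S x - D) (j : ℤ) : cnt N (ownS S) j = f j := by
  have hcard : f j = (Finset.Ico (S j) (S j + f j)).card := by simp
  rw [hcard]
  unfold cnt
  refine Finset.card_bij (fun x _ => S (x + 1)) ?_ ?_ ?_
  · intro x hx
    rw [mem_fib] at hx
    obtain ⟨_, a1, a2, a3⟩ := hx
    rw [Finset.mem_Ico]
    refine ⟨a2, ?_⟩
    have := hS j
    rcases eq_or_lt_of_le a1 with e | e
    · subst e; omega
    · have := a3 (j + 1) (by omega) (by omega); omega
  · intro x hx y hy hxy
    rw [mem_fib] at hx hy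
    obtain ⟨_, a1, a2, a3⟩ := hx
    obtain ⟨_, b1, b2, b3⟩ := hy
    rcases lt_trichotomy x y with hlt | heq | hgt
    · have := b3 (x + 1) (by omega) (by omega); omega
    · exact heq
    · have := a3 (y + 1) (by omega) (by omega); omega
  · intro v hv
    rw [Finset.mem_Ico] at hv
    obtain ⟨x, ⟨hx1, hx2⟩, hmin⟩ := Int.exists_least_of_bdd
      (P := fun x => j ≤ x ∧ S (x + 1) ≤ v) ⟨j, fun z hz => hz.1⟩
      ⟨j + N - 1, by omega, by rw [sub_add_cancel, hD]; omega⟩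
    have hlast := hmin (j + N - 1) ⟨by omega, by rw [sub_add_cancel, hD]; omega⟩
    have hsj := hS j
    have hbig : ∀ i, j < i → i ≤ x → v < S i := by
      intro i hi hi'
      by_contra hh
      have := hmin (i - 1) ⟨by omega, by rw [sub_add_cancel]; omega⟩
      omega
    have hv' : S (x + 1) = v := by
      rcases eq_or_lt_of_le hx1 with e | e
      · subst e; omega
      · have h1 := hbig x e (le_refl _)
        have h2 := hS x
        omega
    refine ⟨x, ?_, hv'⟩
    rw [mem_fib]
    refine ⟨⟨hx1, by omega⟩, hx1, by omega, ?_⟩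
    rw [hv']
    exact hbig

/-! ### Transport to finpartitions of `Fin (2 * N)` -/

def toF {N : ℕ} (hN : 0 < N) (x : ℤ) : Fin (2 * N) :=
  ⟨(x % (2 * N : ℤ)).toNat, by
    have h1 := Int.emod_nonneg x (b := (2 * N : ℤ)) (by omega)
    have h2 := Int.emod_lt_of_pos x (b := (2 * N : ℤ)) (by omega)
    omega⟩

section transport

variable {N : ℕ} (hN : 0 < N)

theorem toF_val (x : ℤ) : (((toF hN x : Fin (2 * N)) : ℕ) : ℤ) = x % (2 * N : ℤ) := by
  have h1 := Int.emod_nonneg x (b := (2 * N : ℤ)) (by omega)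
  simp [toF, h1]

theorem toF_eq_iff (x y : ℤ) : toF hN x = toF hN y ↔ x % (2 * N : ℤ) = y % (2 * N : ℤ) := by
  rw [← toF_val hN, ← toF_val hN, Fin.ext_iff]
  omega

theorem toF_add (x q : ℤ) : toF hN (x + 2 * N * q) = toF hN x := by
  rw [toF_eq_iff, Int.add_mul_emod_self_left]

theorem toF_coe (u : Fin (2 * N)) : toF hN ((u : ℕ) : ℤ) = u := by
  have h := toF_val hN ((u : ℕ) : ℤ)
  rw [Int.emod_eq_of_lt (by omega) (by have := u.isLt; omega)] at h
  ext
  omega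

theorem toF_small (x : ℤ) (h0 : 0 ≤ x) (h1 : x < 2 * N) :
    (((toF hN x : Fin (2 * N)) : ℕ) : ℤ) = x := by
  rw [toF_val, Int.emod_eq_of_lt h0 h1]

theorem toF_decomp (x : ℤ) : ∃ q, x = ((toF hN x : Fin (2 * N)) : ℕ) + 2 * (N : ℤ) * q := by
  refine ⟨x / (2 * N), ?_⟩
  rw [toF_val]
  exact (Int.emod_add_mul_ediv x (2 * N)).symm

theorem toF_inj (x y a : ℤ) (hx : a ≤ x) (hx' : x < a + 2 * N) (hy : a ≤ y) (hy' : y < a + 2 * N)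
    (h : toF hN x = toF hN y) : x = y := by
  rw [toF_eq_iff] at h
  have h1 : (2 * N : ℤ) ∣ y - x := Int.ModEq.dvd h
  have := Int.eq_zero_of_abs_lt_dvd h1 (by rw [abs_lt]; omega)
  omega

/-- lift an element of `Fin (2N)` into a given window -/
theorem toF_lift (u : Fin (2 * N)) (a : ℤ) : ∃ x, a ≤ x ∧ x < a + 2 * N ∧ toF hN x = u := by
  have h1 := Int.emod_nonneg (((u : ℕ) : ℤ) - a) (b := (2 * N : ℤ)) (by omega)
  have h2 := Int.emod_lt_of_pos (((u : ℕ) : ℤ) - a) (b := (2 * N : ℤ)) (by omega)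
  refine ⟨a + (((u : ℕ) : ℤ) - a) % (2 * N), by omega, by omega, ?_⟩
  have h3 := Int.emod_add_mul_ediv (((u : ℕ) : ℤ) - a) (2 * N)
  rw [← toF_add hN _ ((((u : ℕ) : ℤ) - a) / (2 * N))]
  rw [show a + (((u : ℕ) : ℤ) - a) % (2 * N) + 2 * N * ((((u : ℕ) : ℤ) - a) / (2 * N))
    = ((u : ℕ) : ℤ) by linarith]
  exact toF_coe hN u

theorem negB_toF (x : ℤ) : negB (toF hN x) = toF hN (x + N) := by
  apply Fin.ext
  zify
  rw [toF_val]
  simp only [negB]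
  push_cast
  rw [toF_val]
  simp

def relP (π : Finpartition (Finset.univ : Finset (Fin (2 * N)))) (x y : ℤ) : Prop :=
  π.part (toF hN x) = π.part (toF hN y)

theorem mem_NCB (π : Finpartition (Finset.univ : Finset (Fin (2 * N)))) :
    π ∈ NCB N ↔ IsNoncrossing π ∧ (∀ B ∈ π.parts, negBlock B ∈ π.parts) ∧
    (π.parts.filter (fun B => negBlock B = B)).card ≤ 1 := by
  rw [NCB, mem_fil]
  simp

theorem part_neg (π : Finpartition (Finset.univ : Finset (Fin (2 * N))))
    (hπ : ∀ B ∈ π.parts, negBlock B ∈ π.parts) (x : ℤ) :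
    π.part (toF hN (x + N)) = negBlock (π.part (toF hN x)) := by
  apply π.part_eq_of_mem
  · exact hπ _ (π.part_mem.2 (Finset.mem_univ _))
  · rw [← negB_toF]
    exact Finset.mem_image_of_mem _ (π.mem_part (Finset.mem_univ _))

theorem nc_lin (π : Finpartition (Finset.univ : Finset (Fin (2 * N)))) (hnc : IsNoncrossing π)
    (a b c d : ℤ) (h0 : 0 ≤ a) (hab : a < b) (hbc : b < c) (hcd : c < d) (hd : d < 2 * N)
    (hac : relP hN π a c) (hbd : relP hN π b d) : relP hN π a b := by
  have ea := toF_small hN a (by omega) (by omega)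
  have eb := toF_small hN b (by omega) (by omega)
  have ec := toF_small hN c (by omega) (by omega)
  have ed := toF_small hN d (by omega) (by omega)
  refine hnc (toF hN a) (toF hN b) (toF hN c) (toF hN d) ?_ ?_ ?_ _
    (π.part_mem.2 (Finset.mem_univ _)) _ (π.part_mem.2 (Finset.mem_univ _))
    (π.mem_part (Finset.mem_univ _)) ?_ (π.mem_part (Finset.mem_univ _)) ?_
  · rw [Fin.lt_def]; omega
  · rw [Fin.lt_def]; omega
  · rw [Fin.lt_def]; omega
  · rw [hac]; exact π.mem_part (Finset.mem_univ _)
  · rw [hbd]; exact π.mem_part (Finset.mem_univ _)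

theorem relP_congr (π : Finpartition (Finset.univ : Finset (Fin (2 * N)))) (x y q p : ℤ) :
    relP hN π (x + 2 * N * q) (y + 2 * N * p) ↔ relP hN π x y := by
  simp only [relP, toF_add]

theorem relP_brel (π : Finpartition (Finset.univ : Finset (Fin (2 * N)))) (hπ : π ∈ NCB N) :
    BRel N (relP hN π) := by
  rw [mem_NCB] at hπ
  obtain ⟨hnc, hneg, _⟩ := hπ
  have hper : ∀ x, toF hN (x - 2 * N) = toF hN x := by
    intro x
    have := toF_add hN x (-1)
    rwa [show x + 2 * N * (-1) = x - 2 * N by ring] at this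
  refine ⟨fun x => rfl, fun x y h => h.symm, fun x y z h h' => h.trans h', ?_, ?_, ?_⟩
  · intro x y h
    unfold relP at *
    rw [part_neg hN π hneg, part_neg hN π hneg, h]
  · intro x
    unfold relP
    have := toF_add hN x 1
    rw [mul_one] at this
    rw [this]
  · have key : ∀ a b c d : ℤ, 0 ≤ a → a < 2 * N → a < b → b < c → c < d → d < a + 2 * N →
        relP hN π a c → relP hN π b d → relP hN π a b := by
      intro a b c d h0 h1 hab hbc hcd hda hac hbd
      by_cases hd : d < 2 * N
      · exact nc_lin hN π hnc a b c d h0 hab hbc hcd hd hac hbd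
      have hbd' : relP hN π b (d - 2 * N) := by unfold relP; rw [hper]; exact hbd
      by_cases hc : c < 2 * N
      · have := nc_lin hN π hnc (d - 2 * N) a b c (by omega) (by omega) hab hbc hc hbd'.symm hac
        exact this.symm.trans hbd'.symm
      have hac' : relP hN π a (c - 2 * N) := by unfold relP; rw [hper]; exact hac
      by_cases hb : b < 2 * N
      · have := nc_lin hN π hnc (c - 2 * N) (d - 2 * N) a b (by omega) (by omega) (by omega) hab hb
          hac'.symm hbd'.symm
        exact hac'.trans (this.trans hbd'.symm)
      have hbd'' : relP hN π (b - 2 * N) (d - 2 * N) := by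
        unfold relP; rw [hper, hper]; exact hbd
      have := nc_lin hN π hnc (b - 2 * N) (c - 2 * N) (d - 2 * N) a (by omega) (by omega)
        (by omega) (by omega) h1 hbd'' hac'.symm
      exact hac'.trans (this.symm.trans (by rw [hper]))
    intro a b c d hab hbc hcd hda hac hbd
    have h1 := Int.emod_nonneg a (b := (2 * N : ℤ)) (by omega)
    have h2 := Int.emod_lt_of_pos a (b := (2 * N : ℤ)) (by omega)
    have h3 := Int.emod_add_mul_ediv a (2 * N)
    set q := -(a / (2 * N : ℤ)) with hq
    have e : a + 2 * N * q = a % (2 * N : ℤ) := by rw [hq]; linarith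
    rw [← relP_congr hN π _ _ q q] at hac hbd ⊢
    exact key _ _ _ _ (by omega) (by omega) (by omega) (by omega) (by omega) (by omega) hac hbd

theorem relP_ext (π π' : Finpartition (Finset.univ : Finset (Fin (2 * N))))
    (h : ∀ x y, relP hN π x y ↔ relP hN π' x y) : π = π' := by
  have hp : ∀ u, π.part u = π'.part u := by
    intro u
    ext v
    have := h ((v : ℕ) : ℤ) ((u : ℕ) : ℤ)
    simp only [relP, toF_coe] at this
    rw [π.mem_part_iff_part_eq_part (Finset.mem_univ _) (Finset.mem_univ _),
      π'.mem_part_iff_part_eq_part (Finset.mem_univ _) (Finset.mem_univ _)]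
    exact this
  apply Finpartition.ext
  have : ∀ (σ : Finpartition (Finset.univ : Finset (Fin (2 * N)))) B,
      B ∈ σ.parts ↔ ∃ u, σ.part u = B := by
    intro σ B
    constructor
    · intro hB
      obtain ⟨u, hu⟩ := σ.nonempty_of_mem_parts hB
      exact ⟨u, σ.part_eq_of_mem hB hu⟩
    · rintro ⟨u, rfl⟩
      exact σ.part_mem.2 (Finset.mem_univ _)
  ext B
  rw [this, this]
  simp only [hp]

theorem exists_part (r : ℤ → ℤ → Prop) (hr : BRel N r) :
    ∃ π ∈ NCB N, ∀ x y, relP hN π x y ↔ r x y := by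
  classical
  let s : Setoid (Fin (2 * N)) :=
    ⟨fun u v => r ((u : ℕ) : ℤ) ((v : ℕ) : ℤ), fun u => hr.refl _, fun h => hr.symm _ _ h,
      fun h h' => hr.trans _ _ _ h h'⟩
  let π := Finpartition.ofSetoid s
  have hlift : ∀ x, r x ((toF hN x : Fin (2 * N)) : ℕ) := by
    intro x
    obtain ⟨q, hq⟩ := toF_decomp hN x
    have := hr.perq ((toF hN x : Fin (2 * N)) : ℕ) q
    rw [← hq] at this
    exact hr.symm _ _ this
  have hmem : ∀ u v, v ∈ π.part u ↔ r ((u : ℕ) : ℤ) ((v : ℕ) : ℤ) := by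
    intro u v
    exact Finpartition.mem_part_ofSetoid_iff_rel
  have hpart : ∀ u v, π.part u = π.part v ↔ r ((u : ℕ) : ℤ) ((v : ℕ) : ℤ) := by
    intro u v
    rw [← π.mem_part_iff_part_eq_part (Finset.mem_univ _) (Finset.mem_univ _), hmem]
    exact ⟨fun h => hr.symm _ _ h, fun h => hr.symm _ _ h⟩
  have hrel : ∀ x y, relP hN π x y ↔ r x y := by
    intro x y
    unfold relP
    rw [hpart]
    exact ⟨fun h => hr.trans _ _ _ (hlift x) (hr.trans _ _ _ h (hr.symm _ _ (hlift y))),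
      fun h => hr.trans _ _ _ (hr.symm _ _ (hlift x)) (hr.trans _ _ _ h (hlift y))⟩
  have hneg : ∀ u : Fin (2 * N), r ((u : ℕ) + N) ((negB u : Fin (2 * N)) : ℕ) := by
    intro u
    have := hlift ((u : ℕ) + N)
    rwa [← negB_toF, toF_coe] at this
  have hneg2 : ∀ u : Fin (2 * N), negB (negB u) = u := by
    intro u
    conv_lhs => rw [← toF_coe hN u]
    rw [negB_toF, negB_toF]
    have := toF_add hN (u : ℕ) 1
    rw [show ((u : ℕ) : ℤ) + N + N = (u : ℕ) + 2 * N * 1 by ring, this, toF_coe]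
  have hnegr : ∀ u v : Fin (2 * N), r ((u : ℕ) : ℤ) ((v : ℕ) : ℤ) →
      r ((negB u : Fin (2 * N)) : ℕ) ((negB v : Fin (2 * N)) : ℕ) := by
    intro u v h
    exact hr.trans _ _ _ (hr.symm _ _ (hneg u)) (hr.trans _ _ _ (hr.shift _ _ h) (hneg v))
  refine ⟨π, ?_, hrel⟩
  rw [mem_NCB]
  refine ⟨?_, ?_, ?_⟩
  · intro a b c d hab hbc hcd B hB C hC ha hc hb hd
    have ha' := π.part_eq_of_mem hB ha
    have hc' := π.part_eq_of_mem hB hc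
    have hb' := π.part_eq_of_mem hC hb
    have hd' := π.part_eq_of_mem hC hd
    rw [← ha', ← hb', hpart]
    have := d.isLt
    rw [Fin.lt_def] at hab hbc hcd
    exact hr.nc a b c d (by omega) (by omega) (by omega) (by omega)
      ((hpart _ _).1 (ha'.trans hc'.symm)) ((hpart _ _).1 (hb'.trans hd'.symm))
  · intro B hB
    obtain ⟨u, hu⟩ := π.nonempty_of_mem_parts hB
    have : negBlock B = π.part (negB u) := by
      rw [← π.part_eq_of_mem hB hu]
      ext v
      rw [negBlock, Finset.mem_image, hmem]
      constructor
      · rintro ⟨w, hw, rfl⟩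
        rw [hmem] at hw
        exact hnegr _ _ hw
      · intro h
        refine ⟨negB v, ?_, hneg2 v⟩
        rw [hmem]
        have := hnegr _ _ h
        rwa [hneg2] at this
    rw [this]
    exact π.part_mem.2 (Finset.mem_univ _)
  · rw [Finset.card_le_one]
    have hz : ∀ B ∈ π.parts, negBlock B = B → ∀ u ∈ B, r ((u : ℕ) : ℤ) ((u : ℕ) + N) := by
      intro B hB hBn u hu
      have h1 : negB u ∈ B := by
        rw [← hBn]; exact Finset.mem_image_of_mem _ hu
      have h2 := (hpart u (negB u)).1
        ((π.part_eq_of_mem hB hu).trans (π.part_eq_of_mem hB h1).symm)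
      exact hr.trans _ _ _ h2 (hr.symm _ _ (hneg u))
    intro B hB C hC
    rw [Finset.mem_filter] at hB hC
    obtain ⟨u, hu⟩ := π.nonempty_of_mem_parts hB.1
    obtain ⟨v, hv⟩ := π.nonempty_of_mem_parts hC.1
    rw [← π.part_eq_of_mem hB.1 hu, ← π.part_eq_of_mem hC.1 hv, hpart]
    exact hr.zero_rel (by omega) _ _ (hz B hB.1 hB.2 u hu) (hz C hC.1 hC.2 v hv)

/-- the counting function of a type B partition -/
noncomputable def cntP (π : Finpartition (Finset.univ : Finset (Fin (2 * N)))) (j : ℤ) : ℕ :=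
  cnt N (ownR N (relP hN π)) j

theorem block_card (π : Finpartition (Finset.univ : Finset (Fin (2 * N)))) (hπ : π ∈ NCB N)
    (j : ℤ) (hj : ownR N (relP hN π) j j) : (π.part (toF hN j)).card = cntP hN π j := by
  have hr := relP_brel hN π hπ
  unfold cntP cnt
  symm
  refine Finset.card_bij (fun x _ => toF hN x) ?_ ?_ ?_
  · intro x hx
    rw [mem_fib] at hx
    rw [π.mem_part_iff_part_eq_part (Finset.mem_univ _) (Finset.mem_univ _)]
    exact hx.2.2.2.1.symm
  · intro x hx y hy hxy
    rw [mem_fib] at hx hy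
    exact toF_inj hN x y j (by omega) (by omega) (by omega) (by omega) hxy
  · intro u hu
    obtain ⟨x, hx1, hx2, rfl⟩ := toF_lift hN u (j - N)
    rw [π.mem_part_iff_part_eq_part (Finset.mem_univ _) (Finset.mem_univ _)] at hu
    change relP hN π x j at hu
    obtain ⟨a1, a2, a3, a4, a5⟩ := hj
    have hge : j ≤ x := by
      by_contra hh
      rcases eq_or_lt_of_le hx1 with e | e
      · have := hr.shift _ _ hu
        rw [← e, sub_add_cancel] at this
        exact a4 this
      · exact a5 x e (by omega) hu
    refine ⟨x, ?_, rfl⟩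
    rw [mem_fib]
    exact ⟨⟨hge, by omega⟩, hge, by omega, hu.symm, a4, a5⟩

theorem cntP_per (π : Finpartition (Finset.univ : Finset (Fin (2 * N)))) (hπ : π ∈ NCB N)
    (j : ℤ) : cntP hN π (j + N) = cntP hN π j :=
  ((relP_brel hN π hπ).nest (by omega)).cnt_per j

theorem opener_of_pos (π : Finpartition (Finset.univ : Finset (Fin (2 * N)))) (hπ : π ∈ NCB N)
    (j : ℤ) (h : 1 ≤ cntP hN π j) : ownR N (relP hN π) j j := by
  obtain ⟨x, hx⟩ := Finset.card_pos.1 (show 0 < (fib N (ownR N (relP hN π)) j).card from h)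
  rw [mem_fib] at hx
  exact ((relP_brel hN π hπ).nest (by omega)).self _ _ hx.2

theorem blocks_card (π : Finpartition (Finset.univ : Finset (Fin (2 * N)))) (hπ : π ∈ NCB N)
    (s : ℕ) (hs : 1 ≤ s) :
    (π.parts.filter (fun B => negBlock B ≠ B ∧ B.card = s)).card =
      ((Finset.Ico (0 : ℤ) (2 * N)).filter (fun j => cntP hN π j = s)).card := by
  have hr := relP_brel hN π hπ
  have hN' : (0 : ℤ) < N := by omega
  have hneg := ((mem_NCB π).1 hπ).2.1
  symm
  refine Finset.card_bij (fun j _ => π.part (toF hN j)) ?_ ?_ ?_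
  · intro j hj
    rw [Finset.mem_filter] at hj
    have ho := opener_of_pos hN π hπ j (by omega)
    rw [Finset.mem_filter]
    refine ⟨π.part_mem.2 (Finset.mem_univ _), ?_, ?_⟩
    · intro hh
      rw [← part_neg hN π hneg] at hh
      exact ho.2.2.2.1 hh.symm
    · rw [block_card hN π hπ j ho]; exact hj.2
  · intro j hj j' hj' hjj
    rw [Finset.mem_filter, Finset.mem_Ico] at hj hj'
    have ho := opener_of_pos hN π hπ j (by omega)
    have ho' := opener_of_pos hN π hπ j' (by omega)
    obtain ⟨q, hq⟩ := hr.opener_unique hN' j j' ho ho' hjj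
    have : toF hN j' = toF hN j := by rw [hq, toF_add]
    exact (toF_inj hN j' j 0 (by omega) (by omega) (by omega) (by omega) this).symm
  · intro B hB
    rw [Finset.mem_filter] at hB
    obtain ⟨hB, hBn, hBs⟩ := hB
    obtain ⟨u, hu⟩ := π.nonempty_of_mem_parts hB
    have hBu := π.part_eq_of_mem hB hu
    have hz : ¬ relP hN π ((u : ℕ) : ℤ) ((u : ℕ) + N) := by
      intro hh
      unfold relP at hh
      rw [part_neg hN π hneg, toF_coe, hBu] at hh
      exact hBn hh.symm
    obtain ⟨i, hi⟩ := hr.exists_own hN' _ hz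
    obtain ⟨j, hj0, hj1, hji⟩ := toF_lift hN (toF hN i) 0
    have hpi : π.part (toF hN i) = B := by
      have : relP hN π i (u : ℕ) := hi.2.2.1
      unfold relP at this
      rw [this, toF_coe, hBu]
    have hoi := (hr.nest hN').self _ _ hi
    have hoj : ownR N (relP hN π) j j := by
      rw [toF_eq_iff] at hji
      obtain ⟨q, hq⟩ := Int.ModEq.dvd (show i ≡ j [ZMOD (2 * N)] from hji.symm)
      have := (hr.nest hN').shiftq _ _ (2 * q) hoi
      rwa [show i + N * (2 * q) = j by linarith] at this
    refine ⟨j, ?_, by rw [hji, hpi]⟩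
    rw [Finset.mem_filter, Finset.mem_Ico]
    refine ⟨⟨hj0, by omega⟩, ?_⟩
    rw [← block_card hN π hπ j hoj, hji, hpi, hBs]

theorem blocks_card' (π : Finpartition (Finset.univ : Finset (Fin (2 * N)))) (hπ : π ∈ NCB N)
    (s : ℕ) (hs : 1 ≤ s) :
    (π.parts.filter (fun B => negBlock B ≠ B ∧ B.card = s)).card =
      2 * ((Finset.univ : Finset (Fin N)).filter (fun i : Fin N => cntP hN π ((i : ℕ) : ℤ) = s)).card := by
  rw [blocks_card hN π hπ s hs]
  have h1 : (Finset.Ico (0 : ℤ) (2 * N)).filter (fun j => cntP hN π j = s) =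
      ((Finset.univ : Finset (Fin N)).filter (fun i : Fin N => cntP hN π ((i : ℕ) : ℤ) = s)).image
        (fun i : Fin N => ((i : ℕ) : ℤ)) ∪
      ((Finset.univ : Finset (Fin N)).filter (fun i : Fin N => cntP hN π ((i : ℕ) : ℤ) = s)).image
        (fun i : Fin N => ((i : ℕ) : ℤ) + N) := by
    ext x
    simp only [Finset.mem_filter, Finset.mem_Ico, Finset.mem_union, Finset.mem_image,
      Finset.mem_univ, true_and]
    constructor
    · rintro ⟨⟨h0, h1⟩, h2⟩
      by_cases hx : x < N
      · left
        refine ⟨⟨x.toNat, by omega⟩, ?_, ?_⟩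
        · simpa [h0] using h2
        · simp [h0]
      · right
        have h0' : 0 ≤ x - N := by omega
        refine ⟨⟨(x - N).toNat, by omega⟩, ?_, ?_⟩
        · rw [← cntP_per hN π hπ]
          simp only [Int.toNat_of_nonneg h0', sub_add_cancel]
          exact h2
        · simp only [Int.toNat_of_nonneg h0', sub_add_cancel]
    · rintro (⟨i, hi, rfl⟩ | ⟨i, hi, rfl⟩)
      · have := i.isLt
        exact ⟨⟨by omega, by omega⟩, hi⟩
      · have := i.isLt
        refine ⟨⟨by omega, by omega⟩, ?_⟩
        rw [cntP_per hN π hπ]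
        exact hi
  rw [h1, Finset.card_union_of_disjoint, Finset.card_image_of_injective,
    Finset.card_image_of_injective, two_mul]
  · intro i j hij
    simp only at hij
    ext; omega
  · intro i j hij
    simp only at hij
    ext; omega
  · rw [Finset.disjoint_left]
    intro x hx hx'
    rw [Finset.mem_image] at hx hx'
    obtain ⟨i, _, hi⟩ := hx
    obtain ⟨j, _, hj⟩ := hx'
    have := i.isLt
    omega

/-- the code of a type B partition -/
noncomputable def code (π : Finpartition (Finset.univ : Finset (Fin (2 * N)))) : Fin N → ℕ :=
  fun i => cntP hN π ((i : ℕ) : ℤ)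

theorem sum_Ico_fin (f : ℤ → ℕ) :
    ∑ j ∈ Finset.Ico (0 : ℤ) N, f j = ∑ i : Fin N, f ((i : ℕ) : ℤ) := by
  symm
  refine Finset.sum_bij (fun i _ => ((i : ℕ) : ℤ)) ?_ ?_ ?_ ?_
  · intro i _
    have := i.isLt
    rw [Finset.mem_Ico]; omega
  · intro i _ j _ hij
    ext; omega
  · intro x hx
    rw [Finset.mem_Ico] at hx
    exact ⟨⟨x.toNat, by omega⟩, Finset.mem_univ _, by simp [hx.1]⟩
  · intro i _
    rfl

theorem per_ext (hN : 0 < N) (f g : ℤ → ℕ) (hf : ∀ x, f (x + N) = f x) (hg : ∀ x, g (x + N) = g x)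
    (h : ∀ i : Fin N, f ((i : ℕ) : ℤ) = g ((i : ℕ) : ℤ)) (x : ℤ) : f x = g x := by
  have key : ∀ (f : ℤ → ℕ), (∀ x, f (x + N) = f x) → ∀ x, f x = f (x % N) := by
    intro f hf x
    have hp : Function.Periodic f (N : ℤ) := hf
    have := hp.sub_zsmul_eq (x := x) (x / N)
    rw [← this, Int.emod_def]
    congr 1
    simp; ring
  rw [key f hf, key g hg]
  have h1 := Int.emod_nonneg x (b := (N : ℤ)) (by omega)
  have h2 := Int.emod_lt_of_pos x (b := (N : ℤ)) (by omega)
  have := h ⟨(x % N).toNat, by omega⟩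
  simpa [h1] using this

theorem code_sum (π : Finpartition (Finset.univ : Finset (Fin (2 * N)))) (hπ : π ∈ NCB N) :
    ∑ i, code hN π i ≤ N := by
  have hN' : (0 : ℤ) < N := by omega
  have := ((relP_brel hN π hπ).nest hN').sum_period hN'
  rw [sum_Ico_fin] at this
  exact_mod_cast this

theorem code_inj (π π' : Finpartition (Finset.univ : Finset (Fin (2 * N)))) (hπ : π ∈ NCB N)
    (hπ' : π' ∈ NCB N) (h : code hN π = code hN π') : π = π' := by
  have hN' : (0 : ℤ) < N := by omega
  have hr := relP_brel hN π hπ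
  have hr' := relP_brel hN π' hπ'
  have hc : ∀ x, cntP hN π x = cntP hN π' x :=
    per_ext hN _ _ (cntP_per hN π hπ) (cntP_per hN π' hπ') (fun i => congrFun h i)
  obtain ⟨S, hS⟩ := walk_exists (fun x => (cntP hN π x : ℤ) - 1)
  have e : ownR N (relP hN π) = ownR N (relP hN π') := by
    funext j x
    apply propext
    rw [← (hr.nest hN').recoverS hN' S (fun x => by rw [hS]; unfold cntP; ring),
      ← (hr'.nest hN').recoverS hN' S (fun x => by rw [hS, hc]; unfold cntP; ring)]
  apply relP_ext hN
  intro x y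
  rw [hr.recover hN', hr'.recover hN', e]

theorem code_surj (g : Fin N → ℕ) (hg : ∑ i, g i ≤ N) : ∃ π ∈ NCB N, code hN π = g := by
  have hN' : (0 : ℤ) < N := by omega
  let f : ℤ → ℕ := fun x => g ⟨(x % N).toNat, by
    have h1 := Int.emod_nonneg x (b := (N : ℤ)) (by omega)
    have h2 := Int.emod_lt_of_pos x (b := (N : ℤ)) (by omega)
    omega⟩
  have hfg : ∀ i : Fin N, f ((i : ℕ) : ℤ) = g i := by
    intro i
    simp only [f]
    congr 1
    ext
    simp only
    rw [Int.emod_eq_of_lt (by omega) (by have := i.isLt; omega)]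
    simp
  have hper : ∀ x, f (x + N) = f x := by
    intro x
    simp only [f, Int.add_emod_right]
  obtain ⟨S, hS⟩ := walk_exists (fun x => (f x : ℤ) - 1)
  have hS' : ∀ x, S (x + 1) = S x + f x - 1 := fun x => by rw [hS]; ring
  have hdrift := walk_drift N f S hS' hper
  have hsum := walk_sum f S hS' 0 N hN'.le
  rw [sum_Ico_fin] at hsum
  simp only [hfg] at hsum
  have hD : ∀ x, S (x + N) = S x - (S 0 - S N) := fun x => by have := hdrift x; omega
  have hD0 : 0 ≤ S 0 - S N := by omega
  have hnest := ownS_nest N _ S hD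
  obtain ⟨π, hπ, hrel⟩ := exists_part hN _ (hnest.brel hN')
  refine ⟨π, hπ, ?_⟩
  have e1 : relP hN π = relO N (ownS S) := by
    funext x y; exact propext (hrel x y)
  have e2 : ownR N (relO N (ownS S)) = ownS S := by
    funext x y; exact propext (hnest.recover hN' x y)
  funext i
  unfold code cntP
  rw [e1, e2, ownS_cnt N _ hN' hD0 f S hS' hD, hfg]

end transport

/-! ### The final count -/

theorem div_iff (k n : ℕ) (hN : 0 < k * n)
    (π : Finpartition (Finset.univ : Finset (Fin (2 * (k * n))))) (hπ : π ∈ NCB (k * n)) :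
    (∀ B ∈ π.parts, k ∣ B.card) ↔ ∀ i, k ∣ code hN π i := by
  constructor
  · intro h i
    rcases Nat.eq_zero_or_pos (code hN π i) with h0 | h0
    · rw [h0]; exact dvd_zero k
    · have ho := opener_of_pos hN π hπ _ h0
      have := block_card hN π hπ _ ho
      unfold code
      rw [← this]
      exact h _ (π.part_mem.2 (Finset.mem_univ _))
  · intro h
    have hnz : ∀ B ∈ π.parts, negBlock B ≠ B → k ∣ B.card := by
      intro B hB hBn
      have hpos : 1 ≤ B.card := Finset.card_pos.2 (π.nonempty_of_mem_parts hB)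
      have h1 := blocks_card' hN π hπ B.card hpos
      have h2 : 0 < (π.parts.filter (fun C => negBlock C ≠ C ∧ C.card = B.card)).card :=
        Finset.card_pos.2 ⟨B, by simp [hB, hBn]⟩
      rw [h1] at h2
      obtain ⟨i, hi⟩ := Finset.card_pos.1 (Nat.pos_of_mul_pos_left h2)
      rw [Finset.mem_filter] at hi
      rw [← hi.2]
      exact h i
    intro B hB
    by_cases hBn : negBlock B = B
    · have hz := ((mem_NCB π).1 hπ).2.2
      have hs := π.sum_card_parts
      rw [← Finset.sum_filter_add_sum_filter_not π.parts (fun B => negBlock B = B)] at hs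
      have hzB : π.parts.filter (fun B => negBlock B = B) = {B} := by
        rw [Finset.card_le_one] at hz
        ext C
        rw [Finset.mem_singleton]
        constructor
        · intro hC
          exact hz C hC B (by simp [hB, hBn])
        · rintro rfl
          simp [hB, hBn]
      rw [hzB, Finset.sum_singleton] at hs
      have hd : k ∣ ∑ C ∈ π.parts.filter (fun B => ¬ negBlock B = B), C.card := by
        apply Finset.dvd_sum
        intro C hC
        rw [Finset.mem_filter] at hC
        exact hnz C hC.1 hC.2
      rw [← Nat.dvd_add_left hd, hs]
      simp only [Finset.card_univ, Fintype.card_fin]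
      exact ⟨2 * n, by ring⟩
    · exact hnz B hB hBn

theorem mem_NCBdiv (k n : ℕ) (hN : 0 < k * n)
    (π : Finpartition (Finset.univ : Finset (Fin (2 * (k * n))))) :
    π ∈ NCBdiv k n ↔ π ∈ NCB (k * n) ∧ ∀ i, k ∣ code hN π i := by
  rw [NCBdiv, mem_fil]
  constructor
  · rintro ⟨h1, h2⟩
    exact ⟨h1, (div_iff k n hN π h1).1 h2⟩
  · rintro ⟨h1, h2⟩
    exact ⟨h1, (div_iff k n hN π h1).2 h2⟩

theorem count_fixed (n k t : ℕ) (hk : 1 ≤ k) (htn : t ≤ n) (hN : 0 < k * n)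
    (i : Fin (k * n)) :
    ((NCBdiv k n).filter (fun π => code hN π i = t * k)).card =
      ((Finset.univ : Finset (Fin (k * n))).finsuppAntidiag (n - t)).card := by
  have hsum : ∀ c : Fin (k * n) → ℕ, ∑ l, c l = c i + ∑ l ∈ Finset.univ.erase i, c l := fun c =>
    (Finset.add_sum_erase _ _ (Finset.mem_univ i)).symm
  have hC : ∀ π ∈ (NCBdiv k n).filter (fun π => code hN π i = t * k),
      ∃ c : Fin (k * n) → ℕ, (∀ l, code hN π l = k * c l) ∧ c i = t ∧ ∑ l, c l ≤ n := by
    intro π hπ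
    rw [Finset.mem_filter, mem_NCBdiv k n hN] at hπ
    obtain ⟨⟨h1, h2⟩, h3⟩ := hπ
    choose c hc using h2
    refine ⟨c, hc, ?_, ?_⟩
    · rw [hc, mul_comm t k] at h3
      exact Nat.eq_of_mul_eq_mul_left hk h3
    · have := code_sum hN π h1
      simp only [hc] at this
      rw [← Finset.mul_sum] at this
      exact Nat.le_of_mul_le_mul_left this hk
  let H : Finpartition (Finset.univ : Finset (Fin (2 * (k * n)))) → Fin (k * n) → ℕ :=
    fun π l => if l = i then n - (∑ m, code hN π m) / k else code hN π l / k
  have hH : ∀ (π) (c : Fin (k * n) → ℕ), (∀ l, code hN π l = k * c l) →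
      ∀ l, H π l = if l = i then n - ∑ m, c m else c l := by
    intro π c hc l
    simp only [H, hc]
    rw [← Finset.mul_sum, Nat.mul_div_cancel_left _ hk, Nat.mul_div_cancel_left _ hk]
  have herase : ∀ (a : ℕ) (c : Fin (k * n) → ℕ),
      ∑ l ∈ Finset.univ.erase i, (if l = i then a else c l) =
        ∑ l ∈ Finset.univ.erase i, c l := by
    intro a c
    apply Finset.sum_congr rfl
    intro l hl
    rw [if_neg (Finset.ne_of_mem_erase hl)]
  refine Finset.card_bij (fun π _ => Finsupp.equivFunOnFinite.symm (H π)) ?_ ?_ ?_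
  · intro π hπ
    obtain ⟨c, hc, hci, hcs⟩ := hC π hπ
    rw [Finset.mem_finsuppAntidiag]
    refine ⟨?_, Finset.subset_univ _⟩
    simp only [Finsupp.equivFunOnFinite_symm_apply_apply, hH π c hc]
    rw [hsum, herase]
    simp only [if_true]
    have := hsum c
    omega
  · intro π hπ π' hπ' hh
    obtain ⟨c, hc, hci, hcs⟩ := hC π hπ
    obtain ⟨c', hc', hci', hcs'⟩ := hC π' hπ'
    have hh' : H π = H π' := Finsupp.equivFunOnFinite.symm.injective hh
    rw [Finset.mem_filter, mem_NCBdiv k n hN] at hπ hπ'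
    apply code_inj hN π π' hπ.1.1 hπ'.1.1
    funext l
    by_cases hl : l = i
    · rw [hl, hπ.2, hπ'.2]
    · have := congrFun hh' l
      rw [hH π c hc, hH π' c' hc', if_neg hl, if_neg hl] at this
      rw [hc, hc', this]
  · intro h hh
    rw [Finset.mem_finsuppAntidiag] at hh
    have hh1 := hh.1
    rw [hsum] at hh1
    let c : Fin (k * n) → ℕ := fun l => if l = i then t else h l
    have hcs : ∑ l, c l = n - h i := by
      rw [hsum]
      simp only [c]
      rw [herase, if_pos trivial]
      omega
    obtain ⟨π, hπ, hcode⟩ := code_surj hN (fun l => k * c l) (by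
      rw [← Finset.mul_sum, hcs]
      exact Nat.mul_le_mul_left _ (Nat.sub_le _ _))
    have hc : ∀ l, code hN π l = k * c l := fun l => by rw [hcode]
    refine ⟨π, ?_, ?_⟩
    · rw [Finset.mem_filter, mem_NCBdiv k n hN]
      refine ⟨⟨hπ, fun l => ⟨c l, hc l⟩⟩, ?_⟩
      rw [hc]
      simp [c, mul_comm]
    · ext l
      rw [Finsupp.equivFunOnFinite_symm_apply_apply, hH π c hc, hcs]
      by_cases hl : l = i
      · rw [if_pos hl, hl]; omega
      · simp [c, hl]

/-- **Theorem 2 (1).** The sum, over all `k`-divisible non-crossing partitions of type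
`B_{kn}`, of the number of unordered pairs `{V, -V}` of non-zero blocks with `|V| = tk`,
equals `nk binom(n(k+1)-t-1, nk-1)`. -/
theorem typeB_k_divisible_sum_pairCount (n k t : ℕ) (hn : 1 ≤ n) (hk : 1 ≤ k)
    (ht1 : 1 ≤ t) (htn : t ≤ n) :
    ∑ π ∈ NCBdiv k n, pairCount π (t * k) =
      n * k * Nat.choose (n * (k + 1) - t - 1) (n * k - 1) := by

  have hN : 0 < k * n := Nat.mul_pos hk hn
  have h1 : ∀ π ∈ NCBdiv k n, pairCount π (t * k) =
      ∑ i : Fin (k * n), if code hN π i = t * k then 1 else 0 := by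
    intro π hπ
    have hπ' := ((mem_NCBdiv k n hN π).1 hπ).1
    unfold pairCount
    rw [blocks_card' hN π hπ' (t * k) (Nat.mul_pos ht1 hk), Nat.mul_div_cancel_left _ two_pos,
      Finset.card_filter]
    rfl
  rw [Finset.sum_congr rfl h1, Finset.sum_comm]
  have h2 : ∀ i ∈ (Finset.univ : Finset (Fin (k * n))),
      (∑ π ∈ NCBdiv k n, if code hN π i = t * k then 1 else 0) =
        Nat.choose (n * (k + 1) - t - 1) (n * k - 1) := by
    intro i _
    rw [← Finset.card_filter, count_fixed n k t hk htn hN i,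
      Finset.card_finsuppAntidiag_nat_eq_choose]
    simp only [Finset.card_univ, Fintype.card_fin]
    have e : k * n = n * k := mul_comm k n
    have e2 : n * (k + 1) = n * k + n := by ring
    rw [e] at hN ⊢
    rw [e2]
    have e3 : n * k + (n - t) - 1 = n * k + n - t - 1 := by omega
    rw [e3]
    apply Nat.choose_symm_of_eq_add
    omega
  rw [Finset.sum_congr rfl h2]
  simp [mul_comm]
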